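/- Let d be a positive integer, ε > 0, let L ≤ d^{-3/4}, let U ⊆ ℝ^d be a measurable set with 0 < vol(U) < ∞, let f* : ℝ^d → [-1,1] be L-Lipschitz with respect to the Euclidean norm, and let h : ℝ^d → ℝ be measurable with |h(x)| ≤ 1 for all x, with h(x) = 0 and f*(x) = 0 for all x ∉ U, and with ℓ_1(h, f*) ≤ ε. Set σ = ε·d^{1/4} and let h̃ be the Gaussian smoothing of h with parameter σ. Then ℓ_1(h̃, f*) ≤ 3ε, and for all x, y ∈ ℝ^d with ‖x − y‖_2 ≤ (ε/(4√2·e))·d^{1/4}, we have |h̃(x) − h̃(y)| ≤ 1/4. -/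

import Mathlib

open MeasureTheory

/-- Density of the centered Gaussian on `ℝ^d` with covariance `σ² I_d`. -/
noncomputable def gaussDensity (d : ℕ) (σ : ℝ) (t : EuclideanSpace ℝ (Fin d)) : ℝ :=
  (2 * Real.pi * σ ^ 2) ^ (-(d : ℝ) / 2) * Real.exp (-‖t‖ ^ 2 / (2 * σ ^ 2))

/-- Gaussian smoothing `h̃(x) = ∫ h(x+t) φ_σ(t) dt`. -/
noncomputable def gaussSmooth (d : ℕ) (σ : ℝ)
    (h : EuclideanSpace ℝ (Fin d) → ℝ) (x : EuclideanSpace ℝ (Fin d)) : ℝ :=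
  ∫ t : EuclideanSpace ℝ (Fin d), h (x + t) * gaussDensity d σ t

/-- `ℓ₁` distance between two functions relative to the uniform distribution on `U`. -/
noncomputable def l1Dist (d : ℕ) (U : Set (EuclideanSpace ℝ (Fin d)))
    (f g : EuclideanSpace ℝ (Fin d) → ℝ) : ℝ :=
  (1 / (volume U).toReal) * ∫ x in U, |f x - g x|


lemma gs_exp_int (d : ℕ) (σ a : ℝ) (hσ : 0 < σ) (ha : 0 < a) :
    ∫ t : EuclideanSpace ℝ (Fin d),
      (2 * Real.pi * σ ^ 2) ^ (-(d : ℝ) / 2) * Real.exp (-(a / (2 * σ ^ 2)) * ‖t‖ ^ 2)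
      = a ^ (-(d : ℝ) / 2) := by
  rw [integral_const_mul, GaussianFourier.integral_rexp_neg_mul_sq_norm (by positivity)]
  have h1 : Real.pi / (a / (2 * σ ^ 2)) = (2 * Real.pi * σ ^ 2) * a⁻¹ := by
    field_simp
  have hp : 0 < 2 * Real.pi * σ ^ 2 := by positivity
  rw [h1, Real.mul_rpow hp.le (by positivity), finrank_euclideanSpace_fin, ← mul_assoc,
    ← Real.rpow_add hp, Real.inv_rpow ha.le, ← Real.rpow_neg ha.le]
  rw [show -(d : ℝ) / 2 + d / 2 = 0 by ring, Real.rpow_zero, one_mul, neg_div]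

lemma gs_int_one (d : ℕ) (σ : ℝ) (hσ : 0 < σ) :
    ∫ t, gaussDensity d σ t = 1 := by
  have := gs_exp_int d σ 1 hσ one_pos
  rw [Real.one_rpow] at this
  rw [← this]
  congr 1
  ext t
  unfold gaussDensity
  congr 2
  ring

lemma gs_integrable (d : ℕ) (σ : ℝ) (hσ : 0 < σ) : Integrable (gaussDensity d σ) :=
  Integrable.of_integral_ne_zero (by rw [gs_int_one d σ hσ]; exact one_ne_zero)

lemma gs_nonneg (d : ℕ) (σ : ℝ) (t : EuclideanSpace ℝ (Fin d)) : 0 ≤ gaussDensity d σ t := by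
  unfold gaussDensity
  have : 0 ≤ 2 * Real.pi * σ ^ 2 := by positivity
  positivity

lemma gs_pow_bound (d : ℕ) (hd : 0 < d) :
    (1 - 1 / (2 * (d : ℝ))) ^ (-(d : ℝ) / 2) ≤ 2 := by
  have hd' : (1 : ℝ) ≤ d := by exact_mod_cast hd
  have h2 : 1 / (2 * (d : ℝ)) ≤ 1 / 2 := by
    apply one_div_le_one_div_of_le <;> linarith
  have h3 : 0 < 1 / (2 * (d : ℝ)) := by positivity
  set a := 1 - 1 / (2 * (d : ℝ)) with ha
  have hapos : 0 < a := by linarith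
  have hb := one_add_mul_le_pow (a := -(1 / (2 * (d : ℝ)))) (by linarith) d
  have hb2 : (1 : ℝ) / 2 ≤ a ^ (d : ℝ) := by
    rw [Real.rpow_natCast]
    refine le_trans (le_of_eq ?_) hb
    field_simp
    norm_num
  have hb3 : a ^ (d : ℝ) ≤ a ^ ((d : ℝ) / 2) :=
    Real.rpow_le_rpow_of_exponent_ge hapos (by linarith) (by linarith)
  rw [neg_div, Real.rpow_neg hapos.le]
  rw [show (2 : ℝ) = (1 / 2)⁻¹ by norm_num]
  apply inv_anti₀ (by norm_num)
  norm_num at hb2 hb3 ⊢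
  linarith

/-- first absolute moment. -/
lemma gs_moment (d : ℕ) (hd : 0 < d) (σ : ℝ) (hσ : 0 < σ) :
    Integrable (fun t => ‖t‖ * gaussDensity d σ t) ∧
    ∫ t, ‖t‖ * gaussDensity d σ t ≤ 2 * σ * Real.sqrt d := by
  have hd' : (1 : ℝ) ≤ d := by exact_mod_cast hd
  have h2 : 1 / (2 * (d : ℝ)) ≤ 1 / 2 := by
    apply one_div_le_one_div_of_le <;> linarith
  have hapos : 0 < 1 - 1 / (2 * (d : ℝ)) := by linarith
  have hI := gs_exp_int d σ _ hσ hapos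
  have hb := gs_pow_bound d hd
  set F : EuclideanSpace ℝ (Fin d) → ℝ := fun t =>
      (2 * Real.pi * σ ^ 2) ^ (-(d : ℝ) / 2) *
        Real.exp (-((1 - 1 / (2 * (d : ℝ))) / (2 * σ ^ 2)) * ‖t‖ ^ 2) with hF
  have hFi : Integrable F := Integrable.of_integral_ne_zero (by
    rw [hI]; exact (Real.rpow_pos_of_pos hapos _).ne')
  have hs : 0 < Real.sqrt d := Real.sqrt_pos.mpr (by linarith)
  have hsq : Real.sqrt d ^ 2 = d := Real.sq_sqrt (by linarith)
  have hle : ∀ t, ‖t‖ * gaussDensity d σ t ≤ (σ * Real.sqrt d) * F t := by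
    intro t
    have e1 : F t = gaussDensity d σ t * Real.exp ((‖t‖ / (2 * σ * Real.sqrt d)) ^ 2) := by
      simp only [hF, gaussDensity]
      rw [mul_assoc ((2 * Real.pi * σ ^ 2) ^ (-(d : ℝ) / 2)), ← Real.exp_add]
      congr 2
      rw [div_pow, mul_pow, hsq]
      field_simp
      ring
    rw [e1]
    set u := ‖t‖ / (2 * σ * Real.sqrt d) with hu
    have hu2 : ‖t‖ = 2 * σ * Real.sqrt d * u := by rw [hu]; field_simp
    have h3 : 2 * u ≤ Real.exp (u ^ 2) := by
      nlinarith [Real.add_one_le_exp (u ^ 2), sq_nonneg (u - 1)]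
    have h4 : ‖t‖ ≤ σ * Real.sqrt d * Real.exp (u ^ 2) := by
      rw [hu2]
      have : 0 < σ * Real.sqrt d := by positivity
      nlinarith
    have := mul_le_mul_of_nonneg_right h4 (gs_nonneg d σ t)
    linarith
  have hnn : ∀ t, 0 ≤ ‖t‖ * gaussDensity d σ t :=
    fun t => mul_nonneg (norm_nonneg _) (gs_nonneg d σ t)
  have hint : Integrable (fun t => ‖t‖ * gaussDensity d σ t) := by
    refine Integrable.mono' (hFi.const_mul (σ * Real.sqrt d)) ?_ ?_
    · exact continuous_norm.aestronglyMeasurable.mul (gs_integrable d σ hσ).aestronglyMeasurable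
    · filter_upwards with t
      rw [Real.norm_of_nonneg (hnn t)]
      exact hle t
  refine ⟨hint, ?_⟩
  calc _ ≤ ∫ t, (σ * Real.sqrt d) * F t := integral_mono hint (hFi.const_mul _) hle
    _ = (σ * Real.sqrt d) * (1 - 1 / (2 * (d : ℝ))) ^ (-(d : ℝ) / 2) := by
      rw [integral_const_mul, hI]
    _ ≤ (σ * Real.sqrt d) * 2 := by gcongr
    _ = _ := by ring

lemma gs_shift (d : ℕ) (σ : ℝ) (h : EuclideanSpace ℝ (Fin d) → ℝ)
    (x : EuclideanSpace ℝ (Fin d)) :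
    gaussSmooth d σ h x = ∫ s, h s * gaussDensity d σ (s - x) := by
  unfold gaussSmooth
  rw [← integral_sub_right_eq_self (fun t => h (x + t) * gaussDensity d σ t) x]
  congr 1
  ext s
  rw [add_sub_cancel]

lemma gs_even (d : ℕ) (σ : ℝ) (x y : EuclideanSpace ℝ (Fin d)) :
    gaussDensity d σ (x - y) = gaussDensity d σ (y - x) := by
  unfold gaussDensity
  rw [norm_sub_rev]

lemma gs_pointwise (d : ℕ) (σ : ℝ) (hσ : 0 < σ) (t v : EuclideanSpace ℝ (Fin d)) :
    |gaussDensity d σ (t - v) - gaussDensity d σ t| ≤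
      5 * Real.exp (‖v‖ ^ 2 / σ ^ 2) * gaussDensity d σ (t - (2 : ℝ) • v)
        - 10 * gaussDensity d σ (t - v) + (5 + 1 / 20) * gaussDensity d σ t := by
  have hC : 0 < (2 * Real.pi * σ ^ 2) ^ (-(d : ℝ) / 2) :=
    Real.rpow_pos_of_pos (by positivity) _
  obtain ⟨w, hw⟩ : ∃ w, w = Real.exp ((2 * inner ℝ t v - ‖v‖ ^ 2) / (2 * σ ^ 2)) := ⟨_, rfl⟩
  have e1 : gaussDensity d σ (t - v) = gaussDensity d σ t * w := by
    rw [hw]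
    unfold gaussDensity
    rw [mul_assoc ((2 * Real.pi * σ ^ 2) ^ (-(d : ℝ) / 2)), ← Real.exp_add, norm_sub_sq_real]
    congr 2
    ring
  have e2 : Real.exp (‖v‖ ^ 2 / σ ^ 2) * gaussDensity d σ (t - (2 : ℝ) • v)
      = gaussDensity d σ t * w ^ 2 := by
    rw [hw]
    unfold gaussDensity
    rw [mul_assoc ((2 * Real.pi * σ ^ 2) ^ (-(d : ℝ) / 2)), ← Real.exp_nat_mul, ← Real.exp_add, mul_left_comm, ← Real.exp_add,
      norm_sub_sq_real, inner_smul_right, norm_smul]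
    congr 2
    norm_num
    field_simp
    ring
  have hg := gs_nonneg d σ t
  rw [mul_assoc 5, e2, e1]
  set g := gaussDensity d σ t
  have : |g * w - g| = g * |w - 1| := by
    rw [show g * w - g = g * (w - 1) by ring, abs_mul, abs_of_nonneg hg]
  rw [this]
  have h3 : |w - 1| ≤ 5 * w ^ 2 - 10 * w + (5 + 1 / 20) := by
    rcases abs_cases (w - 1) with ⟨h, _⟩ | ⟨h, _⟩ <;> rw [h]
    · nlinarith [sq_nonneg (w - 1 - 1 / 10)]
    · nlinarith [sq_nonneg (w - 1 + 1 / 10)]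
  nlinarith

lemma gs_lip (d : ℕ) (σ : ℝ) (hσ : 0 < σ)
    (h : EuclideanSpace ℝ (Fin d) → ℝ)
    (hmeas : Measurable h) (hbd : ∀ x, |h x| ≤ 1) (x y : EuclideanSpace ℝ (Fin d))
    (hxy : ‖x - y‖ ^ 2 / σ ^ 2 ≤ 1 / 128) :
    |gaussSmooth d σ h x - gaussSmooth d σ h y| ≤ 1 / 4 := by
  have hφ := gs_integrable d σ hσ
  have hhφ : ∀ z, Integrable (fun s => h s * gaussDensity d σ (s - z)) := fun z =>
    (hφ.comp_sub_right z).bdd_mul (c := 1) hmeas.aestronglyMeasurable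
      (Filter.Eventually.of_forall (fun s => by simpa using hbd s))
  rw [gs_shift, gs_shift, ← integral_sub (hhφ x) (hhφ y)]
  set v := x - y with hv
  set E := Real.exp (‖v‖ ^ 2 / σ ^ 2) with hE
  have i1 : Integrable (fun s => 5 * E * gaussDensity d σ (s - (y + (2 : ℝ) • v))) :=
    (hφ.comp_sub_right _).const_mul _
  have i2 : Integrable (fun s => 10 * gaussDensity d σ (s - x)) :=
    (hφ.comp_sub_right _).const_mul _
  have i3 : Integrable (fun s => (5 + 1 / 20) * gaussDensity d σ (s - y)) :=
    (hφ.comp_sub_right _).const_mul _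
  have key : ∀ s, ‖h s * gaussDensity d σ (s - x) - h s * gaussDensity d σ (s - y)‖ ≤
      5 * E * gaussDensity d σ (s - (y + (2 : ℝ) • v)) - 10 * gaussDensity d σ (s - x)
        + (5 + 1 / 20) * gaussDensity d σ (s - y) := by
    intro s
    have := gs_pointwise d σ hσ (s - y) v
    rw [show s - y - v = s - x by rw [hv]; abel,
      show s - y - (2 : ℝ) • v = s - (y + (2 : ℝ) • v) by abel] at this
    refine le_trans ?_ this
    rw [← mul_sub, Real.norm_eq_abs, abs_mul]
    exact mul_le_of_le_one_left (abs_nonneg _) (hbd s)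
  have := norm_integral_le_of_norm_le ((i1.sub i2).add i3) (Filter.Eventually.of_forall key)
  rw [← Real.norm_eq_abs]
  refine this.trans ?_
  have e : ∫ s, ((5 * E * gaussDensity d σ (s - (y + (2 : ℝ) • v))
      - 10 * gaussDensity d σ (s - x)) + (5 + 1 / 20) * gaussDensity d σ (s - y))
      = 5 * E - 10 + (5 + 1 / 20) := by
    have i12 : Integrable (fun s => 5 * E * gaussDensity d σ (s - (y + (2 : ℝ) • v))
      - 10 * gaussDensity d σ (s - x)) := i1.sub i2
    rw [integral_add i12 i3, integral_sub i1 i2, integral_const_mul, integral_const_mul,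
      integral_const_mul, integral_sub_right_eq_self, integral_sub_right_eq_self,
      integral_sub_right_eq_self, gs_int_one d σ hσ]
    ring
  refine (le_of_eq e).trans ?_
  have hE2 : E ≤ 1 / (1 - 1 / 128) := by
    refine (Real.exp_le_exp.mpr hxy).trans ?_
    exact Real.exp_bound_div_one_sub_of_interval (by norm_num) (by norm_num)
  norm_num at hE2 ⊢
  linarith

/-- With `L ≤ d^{-3/4}`, `ℓ₁(h, f*) ≤ ε` and `σ = ε·d^{1/4}`, the Gaussian
smoothing `h̃` satisfies `ℓ₁(h̃, f*) ≤ 3ε`, and `|h̃(x) − h̃(y)| ≤ 1/4` whenever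
`‖x − y‖₂ ≤ (ε/(4√2·e))·d^{1/4}`. -/
theorem gaussSmooth_example_parameters
    (d : ℕ) (hd : 0 < d) (ε : ℝ) (hε : 0 < ε) (L : ℝ) (hL : 0 < L)
    (hLle : L ≤ (d : ℝ) ^ (-(3 : ℝ) / 4))
    (U : Set (EuclideanSpace ℝ (Fin d))) (hU : MeasurableSet U)
    (hUpos : 0 < volume U) (hUfin : volume U < ⊤)
    (fstar : EuclideanSpace ℝ (Fin d) → ℝ)
    (hfrange : ∀ x, fstar x ∈ Set.Icc (-1 : ℝ) 1)
    (hfLip : ∀ x y, |fstar x - fstar y| ≤ L * ‖x - y‖)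
    (h : EuclideanSpace ℝ (Fin d) → ℝ)
    (hmeas : Measurable h) (hbd : ∀ x, |h x| ≤ 1)
    (hvanish : ∀ x, x ∉ U → h x = 0 ∧ fstar x = 0)
    (hclose : l1Dist d U h fstar ≤ ε)
    (σ : ℝ) (hσ : σ = ε * (d : ℝ) ^ ((1 : ℝ) / 4)) :
    l1Dist d U (gaussSmooth d σ h) fstar ≤ 3 * ε ∧
    ∀ x y : EuclideanSpace ℝ (Fin d),
      ‖x - y‖ ≤ (ε / (4 * Real.sqrt 2 * Real.exp 1)) * (d : ℝ) ^ ((1 : ℝ) / 4) →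
      |gaussSmooth d σ h x - gaussSmooth d σ h y| ≤ 1 / 4 := by
  have hd' : (1 : ℝ) ≤ d := by exact_mod_cast hd
  have hd0 : (0 : ℝ) < d := by linarith
  have hdp : 0 < (d : ℝ) ^ ((1 : ℝ) / 4) := Real.rpow_pos_of_pos hd0 _
  have hσ0 : 0 < σ := by rw [hσ]; positivity
  constructor
  · have hφ := gs_integrable d σ hσ0
    have hfc : Continuous fstar := by
      have : LipschitzWith ⟨L, hL.le⟩ fstar := LipschitzWith.of_dist_le_mul (fun x y => by
        rw [Real.dist_eq, dist_eq_norm]; exact hfLip x y)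
      exact this.continuous
    have hfb : ∀ x, |fstar x| ≤ 1 := fun x => abs_le.mpr (hfrange x)
    obtain ⟨hmi, hm⟩ := gs_moment d hd σ hσ0
    have hLσ : L * (2 * σ * Real.sqrt d) ≤ 2 * ε := by
      have h1 : L * (2 * σ * Real.sqrt d) ≤
          (d : ℝ) ^ (-(3 : ℝ) / 4) * (2 * σ * Real.sqrt d) := by gcongr
      refine h1.trans (le_of_eq ?_)
      rw [hσ, Real.sqrt_eq_rpow]
      have : (d : ℝ) ^ (-(3 : ℝ) / 4) * (d : ℝ) ^ ((1 : ℝ) / 4) * (d : ℝ) ^ ((1 : ℝ) / 2) = 1 := by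
        rw [← Real.rpow_add hd0, ← Real.rpow_add hd0]
        norm_num
      linear_combination 2 * ε * this
    set g : EuclideanSpace ℝ (Fin d) → ℝ := fun x => |h x - fstar x| with hg
    have hgm : Measurable g := by
      have := hfc.measurable
      simp only [hg]
      fun_prop
    have hgU : U.indicator g = g := by
      rw [Set.indicator_eq_self]
      intro x hx
      by_contra hxU
      exact hx (by simp [hg, hvanish x hxU])
    have hg2 : ∀ x, |g x| ≤ 2 := fun x => by
      simp only [hg, abs_abs]
      have := abs_sub (h x) (fstar x)
      linarith [hbd x, hfb x]
    have hgi : Integrable g := by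
      rw [← hgU, integrable_indicator_iff hU]
      exact Measure.integrableOn_of_bounded hUfin.ne hgm.aestronglyMeasurable
        (Filter.Eventually.of_forall hg2)
    have hgint : ∫ x, g x = ∫ x in U, g x := by
      rw [← integral_indicator hU, hgU]
    set G := convolution g (gaussDensity d σ) (ContinuousLinearMap.mul ℝ ℝ) volume with hG
    have hGi : Integrable G := hgi.integrable_convolution _ hφ
    have hGint : ∫ x, G x = ∫ x in U, g x := by
      rw [hG, integral_convolution _ hgi hφ, gs_int_one d σ hσ0, hgint]
      simp
    have hG0 : ∀ x, 0 ≤ G x := fun x => by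
      rw [hG, convolution_def]
      exact integral_nonneg (fun t => mul_nonneg (abs_nonneg _) (gs_nonneg _ _ _))
    have hGx : ∀ x, G x = ∫ t, g (x + t) * gaussDensity d σ t := by
      intro x
      have := gs_shift d σ g x
      unfold gaussSmooth at this
      rw [this, hG, convolution_def]
      congr 1
      ext t
      rw [gs_even d σ t x]
      rfl
    have bm : ∀ (k : EuclideanSpace ℝ (Fin d) → ℝ) (c : ℝ), Measurable k → (∀ x, |k x| ≤ c) →
        Integrable (fun t => k t * gaussDensity d σ t) := fun k c hk hc =>
      hφ.bdd_mul (c := c) hk.aestronglyMeasurable (Filter.Eventually.of_forall hc)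
    have hpt : ∀ x, |gaussSmooth d σ h x - fstar x| ≤ G x + 2 * ε := by
      intro x
      have hadd : Measurable (fun t : EuclideanSpace ℝ (Fin d) => x + t) := measurable_const_add x
      have j1 : Integrable (fun t => h (x + t) * gaussDensity d σ t) :=
        bm (fun t => h (x + t)) 1 (hmeas.comp hadd) (fun t => hbd _)
      have j2 : Integrable (fun t => fstar x * gaussDensity d σ t) := hφ.const_mul _
      have j3 : Integrable (fun t => g (x + t) * gaussDensity d σ t) :=
        bm (fun t => g (x + t)) 2 (hgm.comp hadd) (fun t => hg2 _)
      have j4 : Integrable (fun t => L * (‖t‖ * gaussDensity d σ t)) := hmi.const_mul _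
      have e1 : gaussSmooth d σ h x - fstar x =
          ∫ t, (h (x + t) * gaussDensity d σ t - fstar x * gaussDensity d σ t) := by
        rw [integral_sub j1 j2, integral_const_mul, gs_int_one d σ hσ0, mul_one]
        rfl
      rw [e1, ← Real.norm_eq_abs]
      refine (norm_integral_le_of_norm_le (j3.add j4) (Filter.Eventually.of_forall ?_)).trans ?_
      · intro t
        rw [← sub_mul, norm_mul, Real.norm_of_nonneg (gs_nonneg d σ t), Real.norm_eq_abs]
        have h1 : |h (x + t) - fstar x| ≤ g (x + t) + L * ‖t‖ := by
          have h2 := hfLip (x + t) x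
          rw [add_sub_cancel_left] at h2
          exact (abs_sub_le _ (fstar (x + t)) _).trans (by simp only [hg]; linarith)
        have := mul_le_mul_of_nonneg_right h1 (gs_nonneg d σ t)
        simp only [Pi.add_apply]
        linarith
      · have e2 := integral_add j3 j4
        refine (le_of_eq e2).trans ?_
        rw [integral_const_mul, ← hGx]
        have := mul_le_mul_of_nonneg_left hm hL.le
        linarith
    have hV : 0 < (volume U).toReal := ENNReal.toReal_pos hUpos.ne' hUfin.ne
    have hcst : IntegrableOn (fun _ : EuclideanSpace ℝ (Fin d) => 2 * ε) U :=
      integrableOn_const hUfin.ne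
    have hfin : ∫ x in U, |gaussSmooth d σ h x - fstar x| ≤
        (∫ x in U, g x) + (volume U).toReal * (2 * ε) := by
      calc _ ≤ ∫ x in U, (G x + 2 * ε) :=
            integral_mono_of_nonneg (Filter.Eventually.of_forall (fun x => abs_nonneg _))
              (hGi.integrableOn.add hcst) (Filter.Eventually.of_forall hpt)
        _ = (∫ x in U, G x) + (volume U).toReal * (2 * ε) := by
            rw [integral_add hGi.integrableOn hcst, setIntegral_const, smul_eq_mul]
            rfl
        _ ≤ _ := by
            have := setIntegral_le_integral (s := U) hGi (Filter.Eventually.of_forall hG0)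
            rw [hGint] at this
            linarith
    unfold l1Dist at hclose ⊢
    have h9 := mul_le_mul_of_nonneg_left hfin (one_div_pos.mpr hV).le
    have h10 : 1 / (volume U).toReal * ((volume U).toReal * (2 * ε)) = 2 * ε := by
      field_simp
    rw [mul_add, h10] at h9
    have h11 : 1 / (volume U).toReal * (∫ x in U, g x) ≤ ε := hclose
    linarith
  · intro x y hxy
    apply gs_lip d σ hσ0 h hmeas hbd
    rw [← div_pow]
    have he : (2 : ℝ) ≤ Real.exp 1 := by linarith [Real.exp_one_gt_d9]
    have hs : Real.sqrt 2 ^ 2 = 2 := Real.sq_sqrt (by norm_num)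
    have hs0 : 0 < Real.sqrt 2 := by positivity
    have h1 : ‖x - y‖ / σ ≤ 1 / (4 * Real.sqrt 2 * Real.exp 1) := by
      rw [div_le_iff₀ hσ0, hσ]
      refine hxy.trans (le_of_eq ?_)
      ring
    have h2 : 1 / (4 * Real.sqrt 2 * Real.exp 1) ≤ 1 / (4 * Real.sqrt 2 * 2) := by
      gcongr
    calc (‖x - y‖ / σ) ^ 2 ≤ (1 / (4 * Real.sqrt 2 * 2)) ^ 2 :=
          pow_le_pow_left₀ (by positivity) (h1.trans h2) 2
      _ = 1 / 128 := by
          rw [div_pow, mul_pow, mul_pow, hs]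
          norm_num
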